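/- arXiv:1605.03880 — 5 statements merged into one kernel-verified Lean document; each statement's English description precedes it below -/
import Mathlib

section
/- There is a strict 2-category (bicategory) A_n with a single object, whose 1-morphisms are the permutations of Fin n with composition given by multiplication in the symmetric group and identity 1-morphism the identity permutation, whose 2-morphisms from a permutation π to a permutation σ are the binary relations α on Fin n with α ≤ graph π ⊓ graph σ, with vertical composition of 2-morphisms given by intersection of relations, identity 2-morphism on π given by graph π, and horizontal composition of 2-morphisms given by composition of binary relations. -/
/-- The graph of a permutation `σ` of `Fin n`: the binary relation consisting of
all pairs `(σ x, x)`. -/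
def permGraph {n : ℕ} (σ : Equiv.Perm (Fin n)) : Fin n → Fin n → Prop :=
  fun a b => a = σ b

/-- Composition of binary relations: `(β ∘ α) z x ↔ ∃ y, β z y ∧ α y x`. -/
def relComp {n : ℕ} (β α : Fin n → Fin n → Prop) : Fin n → Fin n → Prop :=
  fun z x => ∃ y, β z y ∧ α y x

/-- The axioms of a strict 2-category (bicategory) with a single object, whose
1-morphisms form the type `M` with composition `mul` and identity `one`, and whose
2-morphisms from `a : M` to `b : M` are the elements `φ` of the ambient type `Two`
satisfying `Mor2 a b φ`, with vertical composition `vcomp`, identity 2-morphisms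
`id2` and horizontal composition `hcomp`. -/
structure IsStrictTwoCategoryWithOneObject (M : Type*) (mul : M → M → M) (one : M)
    (Two : Type*) (Mor2 : M → M → Two → Prop)
    (vcomp : Two → Two → Two) (id2 : M → Two) (hcomp : Two → Two → Two) : Prop where
  /-- composition of 1-morphisms is associative -/
  mul_assoc : ∀ a b c, mul (mul a b) c = mul a (mul b c)
  /-- `one` is a left identity 1-morphism -/
  one_mul : ∀ a, mul one a = a
  /-- `one` is a right identity 1-morphism -/
  mul_one : ∀ a, mul a one = a
  /-- vertical composition is well defined -/
  vcomp_mem : ∀ {a b c : M} {α β : Two}, Mor2 a b α → Mor2 b c β → Mor2 a c (vcomp β α)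
  /-- vertical composition is associative -/
  vcomp_assoc : ∀ {a b c d : M} {α β γ : Two}, Mor2 a b α → Mor2 b c β → Mor2 c d γ →
    vcomp (vcomp γ β) α = vcomp γ (vcomp β α)
  /-- the identity 2-morphism on `a` is a 2-morphism from `a` to `a` -/
  id2_mem : ∀ a, Mor2 a a (id2 a)
  /-- right vertical unitality -/
  vcomp_id2 : ∀ {a b : M} {α : Two}, Mor2 a b α → vcomp α (id2 a) = α
  /-- left vertical unitality -/
  id2_vcomp : ∀ {a b : M} {α : Two}, Mor2 a b α → vcomp (id2 b) α = α
  /-- horizontal composition is well defined -/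
  hcomp_mem : ∀ {a b c d : M} {α β : Two}, Mor2 a b α → Mor2 c d β →
    Mor2 (mul c a) (mul d b) (hcomp β α)
  /-- horizontal composition is associative -/
  hcomp_assoc : ∀ {a b c d e f : M} {α β γ : Two}, Mor2 a b α → Mor2 c d β → Mor2 e f γ →
    hcomp (hcomp γ β) α = hcomp γ (hcomp β α)
  /-- right horizontal unitality -/
  hcomp_id2_one : ∀ {a b : M} {α : Two}, Mor2 a b α → hcomp α (id2 one) = α
  /-- left horizontal unitality -/
  id2_one_hcomp : ∀ {a b : M} {α : Two}, Mor2 a b α → hcomp (id2 one) α = α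
  /-- horizontal composition of identity 2-morphisms is an identity 2-morphism -/
  id2_hcomp_id2 : ∀ a b, hcomp (id2 a) (id2 b) = id2 (mul a b)
  /-- the interchange law -/
  interchange : ∀ {a b c a' b' c' : M} {α β γ δ : Two}, Mor2 a b α → Mor2 a' b' β →
    Mor2 b c γ → Mor2 b' c' δ →
    vcomp (hcomp δ γ) (hcomp β α) = hcomp (vcomp δ β) (vcomp γ α)

theorem relComp_assoc {n : ℕ} (γ β α : Fin n → Fin n → Prop) :
    relComp (relComp γ β) α = relComp γ (relComp β α) := by
  ext z x
  constructor
  · rintro ⟨y, ⟨w, hγ, hβ⟩, hα⟩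
    exact ⟨w, hγ, y, hβ, hα⟩
  · rintro ⟨w, hγ, y, hβ, hα⟩
    exact ⟨y, ⟨w, hγ, hβ⟩, hα⟩

theorem relComp_permGraph_one {n : ℕ} (α : Fin n → Fin n → Prop) :
    relComp α (permGraph 1) = α := by
  ext z x
  simp [relComp, permGraph]

theorem permGraph_one_relComp {n : ℕ} (α : Fin n → Fin n → Prop) :
    relComp (permGraph 1) α = α := by
  ext z x
  simp [relComp, permGraph]

theorem relComp_permGraph {n : ℕ} (π σ : Equiv.Perm (Fin n)) :
    relComp (permGraph π) (permGraph σ) = permGraph (π * σ) := by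
  ext z x
  simp [relComp, permGraph]

theorem relComp_mono {n : ℕ} {β β' α α' : Fin n → Fin n → Prop} (hβ : β ≤ β') (hα : α ≤ α') :
    relComp β α ≤ relComp β' α' :=
  fun _ _ ⟨y, h, h'⟩ => ⟨y, hβ _ _ h, hα _ _ h'⟩

/-- Composition distributes over intersection when the right factors lie in the graph of a
common permutation. -/
theorem relComp_inf_relComp {n : ℕ} {σ : Equiv.Perm (Fin n)} {α γ : Fin n → Fin n → Prop}
    (hα : α ≤ permGraph σ) (hγ : γ ≤ permGraph σ) (β δ : Fin n → Fin n → Prop) :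
    relComp δ γ ⊓ relComp β α = relComp (δ ⊓ β) (γ ⊓ α) := by
  ext z x
  constructor
  · rintro ⟨⟨y, hδ, hγy⟩, y', hβ, hαy⟩
    obtain rfl : y = y' := (hγ _ _ hγy).trans (hα _ _ hαy).symm
    exact ⟨y, ⟨hδ, hβ⟩, hγy, hαy⟩
  · rintro ⟨y, ⟨hδ, hβ⟩, hγy, hαy⟩
    exact ⟨⟨y, hδ, hγy⟩, y, hβ, hαy⟩

/-- There is a strict 2-category `A_n` with a single object whose 1-morphisms are the
permutations of `Fin n` (with composition the multiplication of the symmetric group and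
identity 1-morphism the identity permutation), whose 2-morphisms from `π` to `σ` are the
binary relations `α` on `Fin n` with `α ≤ graph π ⊓ graph σ`, with vertical composition
given by intersection of relations, identity 2-morphism on `π` given by `graph π`, and
horizontal composition given by composition of binary relations. -/
theorem exists_strict_two_category_An (n : ℕ) :
    IsStrictTwoCategoryWithOneObject (Equiv.Perm (Fin n)) (· * ·) 1
      (Fin n → Fin n → Prop)
      (fun π σ α => α ≤ permGraph π ⊓ permGraph σ)
      (fun β α => β ⊓ α)
      (fun π => permGraph π)
      (fun β α => relComp β α) := by
  exact
  { mul_assoc := mul_assoc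
    one_mul := one_mul
    mul_one := mul_one
    vcomp_mem := fun hα hβ =>
      le_inf (inf_le_right.trans (hα.trans inf_le_left))
        (inf_le_left.trans (hβ.trans inf_le_right))
    vcomp_assoc := fun _ _ _ => inf_assoc _ _ _
    id2_mem := fun _ => le_inf le_rfl le_rfl
    vcomp_id2 := fun hα => inf_eq_left.2 (hα.trans inf_le_left)
    id2_vcomp := fun hα => inf_eq_right.2 (hα.trans inf_le_right)
    hcomp_mem := fun hα hβ => by
      rw [← relComp_permGraph, ← relComp_permGraph]
      exact le_inf (relComp_mono (hβ.trans inf_le_left) (hα.trans inf_le_left))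
        (relComp_mono (hβ.trans inf_le_right) (hα.trans inf_le_right))
    hcomp_assoc := fun _ _ _ => relComp_assoc _ _ _
    hcomp_id2_one := fun _ => relComp_permGraph_one _
    id2_one_hcomp := fun _ => permGraph_one_relComp _
    id2_hcomp_id2 := relComp_permGraph
    interchange := fun hα _ hγ _ =>
      relComp_inf_relComp (hα.trans inf_le_right) (hγ.trans inf_le_left) _ _ }
end

section
/- Let π, σ, ρ, τ, μ, ν be permutations of Fin n and let α, β, γ, δ be binary relations on Fin n with α ≤ graph π ⊓ graph σ, β ≤ graph τ ⊓ graph μ, γ ≤ graph σ ⊓ graph ρ and δ ≤ graph μ ⊓ graph ν. Then the interchange law holds: (δ ∘ γ) ⊓ (β ∘ α) = (δ ⊓ β) ∘ (γ ⊓ α), where ∘ is composition of binary relations and ⊓ is intersection of relations. -/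
/-- The interchange law for the 2-category `A_n`. -/
theorem interchange_law {n : ℕ} (π σ ρ τ μ ν : Equiv.Perm (Fin n))
    (α β γ δ : Fin n → Fin n → Prop)
    (hα : α ≤ permGraph π ⊓ permGraph σ)
    (hβ : β ≤ permGraph τ ⊓ permGraph μ)
    (hγ : γ ≤ permGraph σ ⊓ permGraph ρ)
    (hδ : δ ≤ permGraph μ ⊓ permGraph ν) :
    relComp δ γ ⊓ relComp β α = relComp (δ ⊓ β) (γ ⊓ α) := by
  ext z x
  constructor
  · rintro ⟨⟨y, hδy, hγy⟩, y', hβy, hαy⟩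
    have hy : y = σ x := (hγ y x hγy).1
    have hy' : y' = σ x := (hα y' x hαy).2
    obtain rfl : y = y' := hy.trans hy'.symm
    exact ⟨y, ⟨hδy, hβy⟩, hγy, hαy⟩
  · rintro ⟨y, ⟨hδy, hβy⟩, hγy, hαy⟩
    exact ⟨⟨y, hδy, hγy⟩, y, hβy, hαy⟩
end

section
/- Let r and s be setoids on Fin n ⊕ Fin n each containing the identity matching, that is, G(1) ≤ r and G(1) ≤ s where 1 is the identity permutation of Fin n. Then the partition product of r and s equals their join: r·s = r ⊔ s. -/
/-- The setoid on `Fin n ⊕ Fin n` generated by the pairs `inl x ≈ inr (σ x)`,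
for `σ` a permutation of `Fin n`. -/
def permSetoid {n : ℕ} (σ : Equiv.Perm (Fin n)) : Setoid (Fin n ⊕ Fin n) :=
  Relation.EqvGen.setoid (fun a b => ∃ x : Fin n, a = Sum.inl x ∧ b = Sum.inr (σ x))

/-- The setoid on `T` induced (generated) by the image of a setoid `r` on `X`
along a map `f : X → T`. -/
def inducedSetoid {X T : Type*} (f : X → T) (r : Setoid X) : Setoid T :=
  Relation.EqvGen.setoid (fun t u => ∃ a b : X, r a b ∧ t = f a ∧ u = f b)

/-- The partition product `r · s` of two setoids on `Fin n ⊕ Fin n`, defined via the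
three-layer set `Fin n ⊕ (Fin n ⊕ Fin n)` (layer 1 = `inl`, layer 2 = `inr ∘ inl`,
layer 3 = `inr ∘ inr`): embed `s` identifying layers 1 and 2, embed `r` identifying
layers 2 and 3, take the join, and relate two elements of `Fin n ⊕ Fin n` iff their
images under `inl ↦ layer 1`, `inr ↦ layer 3` are related by this join. -/
def partitionProd {n : ℕ} (r s : Setoid (Fin n ⊕ Fin n)) : Setoid (Fin n ⊕ Fin n) :=
  Setoid.comap
    (Sum.elim (fun x => Sum.inl x) (fun y => Sum.inr (Sum.inr y)))
    (inducedSetoid (Sum.elim (fun x => Sum.inr (Sum.inl x)) (fun y => Sum.inr (Sum.inr y))) r ⊔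
      inducedSetoid (Sum.elim (fun x => Sum.inl x) (fun y => Sum.inr (Sum.inl y))) s)

theorem permSetoid_le_iff {n : ℕ} {σ : Equiv.Perm (Fin n)} {r : Setoid (Fin n ⊕ Fin n)} :
    permSetoid σ ≤ r ↔ ∀ x, r (Sum.inl x) (Sum.inr (σ x)) := by
  refine ⟨fun h x => h (Relation.EqvGen.rel _ _ ⟨x, rfl, rfl⟩), fun h => Setoid.eqvGen_le ?_⟩
  rintro _ _ ⟨x, rfl, rfl⟩
  exact h x

theorem inducedSetoid_le_iff {X T : Type*} {f : X → T} {r : Setoid X} {t : Setoid T} :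
    inducedSetoid f r ≤ t ↔ r ≤ Setoid.comap f t := by
  refine ⟨fun h a b hab => h (Relation.EqvGen.rel _ _ ⟨a, b, hab, rfl, rfl⟩),
    fun h => Setoid.eqvGen_le ?_⟩
  rintro _ _ ⟨a, b, hab, rfl, rfl⟩
  exact h hab

/-- The pullback of a setoid `t` along `f` is contained in its pullback along any map that is
pointwise `t`-related to `f`. -/
theorem Setoid.comap_le_comap_of_rel {X T : Type*} {f g : X → T} {t : Setoid T}
    (h : ∀ a, t (f a) (g a)) : Setoid.comap f t ≤ Setoid.comap g t :=
  fun a b hab => t.trans (t.symm (h a)) (t.trans hab (h b))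

/-- If two setoids on `Fin n ⊕ Fin n` both contain the identity matching `G 1`, then
their partition product equals their join. -/
theorem partitionProd_eq_sup {n : ℕ} (r s : Setoid (Fin n ⊕ Fin n))
    (hr : permSetoid (1 : Equiv.Perm (Fin n)) ≤ r)
    (hs : permSetoid (1 : Equiv.Perm (Fin n)) ≤ s) :
    partitionProd r s = r ⊔ s := by
  have hr1 := permSetoid_le_iff.1 hr
  have hs1 := permSetoid_le_iff.1 hs
  apply le_antisymm
  · -- Collapse the three layers onto two by gluing layers 2 and 3.
    let p : Fin n ⊕ (Fin n ⊕ Fin n) → Fin n ⊕ Fin n :=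
      Sum.elim Sum.inl (Sum.elim Sum.inr Sum.inr)
    have key : inducedSetoid (Sum.elim (fun x => Sum.inr (Sum.inl x))
          (fun y => Sum.inr (Sum.inr y))) r ⊔
        inducedSetoid (Sum.elim (fun x => Sum.inl x) (fun y => Sum.inr (Sum.inl y))) s ≤
        Setoid.comap p (r ⊔ s) := by
      refine sup_le (inducedSetoid_le_iff.2 (le_trans (le_sup_left : r ≤ r ⊔ s) ?_))
        (inducedSetoid_le_iff.2 (le_trans (le_sup_right : s ≤ r ⊔ s) ?_))
      · refine Setoid.comap_le_comap_of_rel (f := id) (t := r ⊔ s)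
          (g := p ∘ Sum.elim (fun x => Sum.inr (Sum.inl x)) (fun y => Sum.inr (Sum.inr y))) ?_
        rintro (x | x)
        · exact (le_sup_left : r ≤ r ⊔ s) (hr1 x)
        · exact (r ⊔ s).refl _
      · refine Setoid.comap_le_comap_of_rel (f := id) (t := r ⊔ s)
          (g := p ∘ Sum.elim (fun x => Sum.inl x) (fun y => Sum.inr (Sum.inl y))) ?_
        rintro (x | x) <;> exact (r ⊔ s).refl _
    rintro (a | a) (b | b) hab <;> exact key hab
  · unfold partitionProd
    set R := inducedSetoid (Sum.elim (fun x : Fin n => Sum.inr (Sum.inl x))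
      (fun y : Fin n => (Sum.inr (Sum.inr y) : Fin n ⊕ (Fin n ⊕ Fin n)))) r with hR
    set S := inducedSetoid (Sum.elim (fun x : Fin n => Sum.inl x)
      (fun y : Fin n => (Sum.inr (Sum.inl y) : Fin n ⊕ (Fin n ⊕ Fin n)))) s with hS
    have hrJ := inducedSetoid_le_iff.1 (hR.ge.trans (le_sup_left : R ≤ R ⊔ S))
    have hsJ := inducedSetoid_le_iff.1 (hS.ge.trans (le_sup_right : S ≤ R ⊔ S))
    refine sup_le (hrJ.trans (Setoid.comap_le_comap_of_rel ?_))
      (hsJ.trans (Setoid.comap_le_comap_of_rel ?_))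
    · rintro (x | x)
      · exact (R ⊔ S).symm (hsJ (hs1 x))
      · exact (R ⊔ S).refl _
    · rintro (x | x)
      · exact (R ⊔ S).refl _
      · exact hrJ (hr1 x)
end

section
/- Consider the commutative monoid M of finite subsets (Finsets) of Fin n under intersection, with identity element the full set. In the monoid algebra ℤ[M], for each X ⊆ Fin n define e_X := Σ_{Y ⊆ X} (-1)^(|X| - |Y|) [Y], where [Y] denotes the basis element of the monoid algebra corresponding to Y. Then: (1) e_X * e_X = e_X for every X; (2) e_X * e_{X'} = 0 whenever X ≠ X'; (3) Σ_{X ⊆ Fin n} e_X = [Fin n], the identity of ℤ[M]. -/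
/-- The commutative monoid of finite subsets of `Fin n` under intersection, with
identity the full set. -/
instance finsetInterCommMonoid (n : ℕ) : CommMonoid (Finset (Fin n)) where
  mul := (· ∩ ·)
  one := Finset.univ
  mul_assoc a b c := Finset.inter_assoc a b c
  one_mul a := Finset.univ_inter a
  mul_one a := Finset.inter_univ a
  mul_comm a b := Finset.inter_comm a b

/-- The idempotent `e_X = ∑_{Y ⊆ X} (-1)^(|X| - |Y|) [Y]` in the monoid algebra
`ℤ[M]`, where `M` is the monoid of finite subsets of `Fin n` under intersection. -/
noncomputable def eIdem (n : ℕ) (X : Finset (Fin n)) :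
    MonoidAlgebra ℤ (Finset (Fin n)) :=
  ∑ Y ∈ X.powerset, MonoidAlgebra.single Y ((-1 : ℤ) ^ (X.card - Y.card))

/-- Splitting an alternating sum over the subsets of `insert a s` according to whether they
contain `a`. -/
theorem sum_powerset_insert_neg_one_pow_smul {α A : Type*} [DecidableEq α] [AddCommGroup A]
    (f : Finset α → A) {a : α} {s : Finset α} (ha : a ∉ s) :
    ∑ t ∈ (insert a s).powerset, (-1 : ℤ) ^ ((insert a s).card - t.card) • f t =
      ∑ t ∈ s.powerset, (-1 : ℤ) ^ (s.card - t.card) • f (insert a t) -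
        ∑ t ∈ s.powerset, (-1 : ℤ) ^ (s.card - t.card) • f t := by
  rw [Finset.sum_powerset_insert ha, sub_eq_neg_add, ← Finset.sum_neg_distrib]
  congr 1 <;> refine Finset.sum_congr rfl fun t ht => ?_
  · have hts := Finset.card_le_card (Finset.mem_powerset.mp ht)
    rw [Finset.card_insert_of_notMem ha, Nat.succ_sub hts, pow_succ]
    simp
  · have hat : a ∉ t := fun h => ha (Finset.mem_powerset.mp ht h)
    rw [Finset.card_insert_of_notMem ha, Finset.card_insert_of_notMem hat,
      Nat.add_sub_add_right]

/-- Möbius inversion over the lattice of finite subsets. -/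
theorem sum_powerset_sum_powerset_neg_one_pow_smul {α A : Type*} [DecidableEq α]
    [AddCommGroup A] (s : Finset α) (f : Finset α → A) :
    ∑ t ∈ s.powerset, ∑ u ∈ t.powerset, (-1 : ℤ) ^ (t.card - u.card) • f u = f s := by
  induction s using Finset.induction_on generalizing f with
  | empty => simp
  | insert a s ha ih =>
    rw [Finset.sum_powerset_insert ha, ← ih fun t => f (insert a t),
      ← Finset.sum_add_distrib]
    refine Finset.sum_congr rfl fun t ht => ?_
    rw [sum_powerset_insert_neg_one_pow_smul f fun h => ha (Finset.mem_powerset.mp ht h)]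
    abel

theorem eIdem_eq_sum_smul (n : ℕ) (X : Finset (Fin n)) :
    eIdem n X = ∑ Y ∈ X.powerset,
      (-1 : ℤ) ^ (X.card - Y.card) • MonoidAlgebra.single Y (1 : ℤ) := by
  simp [eIdem]

theorem single_mul_single_inter {n : ℕ} (Y Z : Finset (Fin n)) (a b : ℤ) :
    (MonoidAlgebra.single Y a * MonoidAlgebra.single Z b : MonoidAlgebra ℤ (Finset (Fin n))) =
      MonoidAlgebra.single (Y ∩ Z) (a * b) :=
  MonoidAlgebra.single_mul_single ..

theorem single_mul_eIdem_of_subset {n : ℕ} {X Y : Finset (Fin n)} (h : X ⊆ Y) (c : ℤ) :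
    MonoidAlgebra.single Y c * eIdem n X = c • eIdem n X := by
  rw [eIdem, Finset.mul_sum, Finset.smul_sum]
  refine Finset.sum_congr rfl fun Z hZ => ?_
  rw [single_mul_single_inter,
    Finset.inter_eq_right.mpr ((Finset.mem_powerset.mp hZ).trans h)]
  simp

theorem single_mul_eIdem_of_not_subset {n : ℕ} {X Y : Finset (Fin n)} (h : ¬X ⊆ Y) (c : ℤ) :
    MonoidAlgebra.single Y c * eIdem n X = 0 := by
  obtain ⟨a, haX, haY⟩ := Finset.not_subset.mp h
  rw [← Finset.insert_erase haX, eIdem_eq_sum_smul,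
    sum_powerset_insert_neg_one_pow_smul _ (Finset.notMem_erase a X), mul_sub, sub_eq_zero,
    Finset.mul_sum, Finset.mul_sum]
  refine Finset.sum_congr rfl fun Z _ => ?_
  rw [mul_smul_comm, mul_smul_comm, single_mul_single_inter, single_mul_single_inter,
    Finset.inter_insert_of_notMem haY]

theorem eIdem_mul_eIdem_of_not_subset {n : ℕ} {X X' : Finset (Fin n)} (h : ¬X' ⊆ X) :
    eIdem n X * eIdem n X' = 0 := by
  rw [eIdem, Finset.sum_mul]
  exact Finset.sum_eq_zero fun Y hY =>
    single_mul_eIdem_of_not_subset (fun hX => h (hX.trans (Finset.mem_powerset.mp hY))) _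

theorem eIdem_mul_self (n : ℕ) (X : Finset (Fin n)) :
    eIdem n X * eIdem n X = eIdem n X := by
  conv_lhs => enter [1]; rw [eIdem]
  rw [Finset.sum_mul, Finset.sum_eq_single_of_mem X (Finset.mem_powerset_self X),
    single_mul_eIdem_of_subset subset_rfl]
  · simp
  · exact fun Y hY hne => single_mul_eIdem_of_not_subset
      (fun hX => hne ((Finset.mem_powerset.mp hY).antisymm hX)) _

/-- The elements `e_X` form a complete family of orthogonal idempotents in the monoid
algebra `ℤ[M]` of the monoid `M` of finite subsets of `Fin n` under intersection,
summing to the identity `[Fin n]`. -/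
theorem eIdem_orthogonal_idempotents (n : ℕ) :
    (∀ X : Finset (Fin n), eIdem n X * eIdem n X = eIdem n X) ∧
    (∀ X X' : Finset (Fin n), X ≠ X' → eIdem n X * eIdem n X' = 0) ∧
    (∑ X : Finset (Fin n), eIdem n X =
      MonoidAlgebra.single (Finset.univ : Finset (Fin n)) 1) := by
  refine ⟨eIdem_mul_self n, fun X X' hne => ?_, ?_⟩
  · by_cases h : X' ⊆ X
    · rw [mul_comm]
      exact eIdem_mul_eIdem_of_not_subset fun h' => hne (h'.antisymm h)
    · exact eIdem_mul_eIdem_of_not_subset h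
  · simp_rw [eIdem_eq_sum_smul]
    rw [← Finset.powerset_univ]
    exact sum_powerset_sum_powerset_neg_one_pow_smul _ _
end

section
/- Consider the commutative monoid L of setoids (equivalence relations) on Fin n under the join operation ⊔, with identity element the bottom setoid ⊥ (equality). Let μ denote the Möbius function of the finite lattice of setoids on Fin n (the Möbius function of its incidence algebra over ℤ). In the monoid algebra ℤ[L], for each setoid P define e_P := Σ_{Q : P ≤ Q} μ(P, Q) [Q]. Then: (1) e_P * e_P = e_P for every P; (2) e_P * e_{P'} = 0 whenever P ≠ P'; (3) Σ_P e_P = [⊥], the identity of ℤ[L]. (These are the idempotents used to split the 2-endomorphism algebra of the identity 1-morphism in the categorification of F*_n.) -/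
attribute [local instance] Classical.propDecidable

instance setoidFinite (n : ℕ) : Finite (Setoid (Fin n)) :=
  Finite.of_injective (fun s : Setoid (Fin n) => s.r)
    (fun a b h => Setoid.ext fun x y => by rw [show a.r = b.r from h])

noncomputable instance setoidFintype (n : ℕ) : Fintype (Setoid (Fin n)) :=
  Fintype.ofFinite _

/-- The commutative monoid of setoids (equivalence relations) on `Fin n` under the
join operation `⊔`, with identity the bottom setoid `⊥` (equality). -/
noncomputable instance setoidJoinCommMonoid (n : ℕ) : CommMonoid (Setoid (Fin n)) where
  mul := (· ⊔ ·)
  one := ⊥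
  mul_assoc a b c := sup_assoc a b c
  one_mul a := bot_sup_eq a
  mul_one a := sup_bot_eq a
  mul_comm a b := sup_comm a b

/-- The element `e_P = ∑_{Q : P ≤ Q} μ(P, Q) [Q]` of the monoid algebra `ℤ[L]`, where
`L` is the monoid of setoids on `Fin n` under join. -/
noncomputable def eMob (n : ℕ) (μ : Setoid (Fin n) → Setoid (Fin n) → ℤ)
    (P : Setoid (Fin n)) : MonoidAlgebra ℤ (Setoid (Fin n)) :=
  ∑ Q ∈ Finset.univ.filter (fun Q : Setoid (Fin n) => P ≤ Q),
    MonoidAlgebra.single Q (μ P Q)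

/-- The character of `ℤ[L]` sending `[Q]` to `1` if `Q ≤ R` and to `0` otherwise. -/
noncomputable def joinCharacter {n : ℕ} (R : Setoid (Fin n)) :
    MonoidAlgebra ℤ (Setoid (Fin n)) →ₐ[ℤ] ℤ :=
  MonoidAlgebra.lift ℤ ℤ (Setoid (Fin n))
    { toFun := fun Q => if Q ≤ R then 1 else 0
      map_one' := if_pos (bot_le : (⊥ : Setoid (Fin n)) ≤ R)
      map_mul' := fun P Q => by
        have h : P * Q ≤ R ↔ P ≤ R ∧ Q ≤ R := sup_le_iff
        by_cases hP : P ≤ R <;> by_cases hQ : Q ≤ R <;> simp [h, hP, hQ] }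

theorem joinCharacter_single {n : ℕ} (R Q : Setoid (Fin n)) (a : ℤ) :
    joinCharacter R (MonoidAlgebra.single Q a) = if Q ≤ R then a else 0 := by
  simp [joinCharacter, MonoidAlgebra.lift_single]

theorem joinCharacter_apply {n : ℕ} (R : Setoid (Fin n))
    (x : MonoidAlgebra ℤ (Setoid (Fin n))) :
    joinCharacter R x = ∑ Q, if Q ≤ R then x.coeff Q else 0 := by
  induction x using MonoidAlgebra.induction_linear with
  | zero => simp
  | add f g hf hg =>
    rw [map_add, hf, hg, ← Finset.sum_add_distrib]
    refine Finset.sum_congr rfl fun Q _ => ?_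
    split_ifs <;> simp
  | single P a =>
    rw [joinCharacter_single, Finset.sum_eq_single P]
    · simp
    · intro Q _ hQ
      simp [hQ.symm]
    · simp

theorem eq_zero_of_joinCharacter_eq_zero {n : ℕ} {x : MonoidAlgebra ℤ (Setoid (Fin n))}
    (hx : ∀ R, joinCharacter R x = 0) : x = 0 := by
  have h : ∀ R, x.coeff R = 0 := fun R => by
    induction R using WellFoundedLT.induction with
    | ind R ih =>
      have hR := hx R
      rw [joinCharacter_apply, Finset.sum_eq_single R] at hR
      · simpa using hR
      · intro Q _ hQ
        split_ifs with hle
        · exact ih Q (lt_of_le_of_ne hle hQ)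
        · rfl
      · simp
  ext R
  simpa using h R

theorem eq_of_joinCharacter_eq {n : ℕ} {x y : MonoidAlgebra ℤ (Setoid (Fin n))}
    (h : ∀ R, joinCharacter R x = joinCharacter R y) : x = y :=
  sub_eq_zero.mp (eq_zero_of_joinCharacter_eq_zero fun R => by rw [map_sub, h, sub_self])

theorem joinCharacter_eMob {n : ℕ} {μ : Setoid (Fin n) → Setoid (Fin n) → ℤ}
    (hμ_refl : ∀ P : Setoid (Fin n), μ P P = 1)
    (hμ_sum : ∀ P R : Setoid (Fin n), P < R →
      ∑ Q ∈ Finset.univ.filter (fun Q : Setoid (Fin n) => P ≤ Q ∧ Q ≤ R), μ P Q = 0)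
    (P R : Setoid (Fin n)) :
    joinCharacter R (eMob n μ P) = if P = R then 1 else 0 := by
  simp only [eMob, map_sum, joinCharacter_single]
  rw [← Finset.sum_filter, Finset.filter_filter]
  split_ifs with h
  · subst h
    rw [Finset.sum_eq_single P]
    · exact hμ_refl P
    · intro Q hQ hne
      simp only [Finset.mem_filter] at hQ
      exact absurd (le_antisymm hQ.2.2 hQ.2.1) hne
    · simp
  · by_cases hle : P ≤ R
    · convert hμ_sum P R (lt_of_le_of_ne hle h)
    · refine Finset.sum_eq_zero fun Q hQ => ?_
      simp only [Finset.mem_filter] at hQ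
      exact absurd (hQ.2.1.trans hQ.2.2) hle

/-- For `μ` the Möbius function of the lattice of setoids on `Fin n` (characterized
by `μ(P, P) = 1` and `∑_{P ≤ Q ≤ R} μ(P, Q) = 0` for `P < R`), the elements `e_P`
form a complete family of orthogonal idempotents of the monoid algebra `ℤ[L]` of the
monoid `L` of setoids on `Fin n` under join, summing to the identity `[⊥]`. -/
theorem eMob_orthogonal_idempotents (n : ℕ)
    (μ : Setoid (Fin n) → Setoid (Fin n) → ℤ)
    (hμ_refl : ∀ P : Setoid (Fin n), μ P P = 1)
    (hμ_sum : ∀ P R : Setoid (Fin n), P < R →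
      ∑ Q ∈ Finset.univ.filter (fun Q : Setoid (Fin n) => P ≤ Q ∧ Q ≤ R), μ P Q = 0) :
    (∀ P : Setoid (Fin n), eMob n μ P * eMob n μ P = eMob n μ P) ∧
    (∀ P P' : Setoid (Fin n), P ≠ P' → eMob n μ P * eMob n μ P' = 0) ∧
    (∑ P : Setoid (Fin n), eMob n μ P =
      MonoidAlgebra.single (⊥ : Setoid (Fin n)) 1) := by
  have key := joinCharacter_eMob hμ_refl hμ_sum
  refine ⟨fun P => ?_, fun P P' hne => ?_, ?_⟩ <;> refine eq_of_joinCharacter_eq fun R => ?_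
  · rw [map_mul, key]
    split_ifs <;> simp
  · rw [map_mul, key, key, map_zero]
    by_cases h : P = R
    · simp [show P' ≠ R from fun h' => hne (h.trans h'.symm)]
    · simp [h]
  · rw [map_sum, joinCharacter_single]
    simp [key]
end
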